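/- Let G and H be two bipartite multigraphs with the same vertex classes V and W, regarded as multisets of edges in V × W. If every vertex has the same degree with respect to G and with respect to H, then the symmetric difference of the multisets of edges of G and H, namely (G − H) ∪ (H − G), can be partitioned into even closed cycles in which any two consecutive edges belong to different graphs (one to G − H and the other to H − G). -/

import Mathlib

open Function in
/-- A permutation of a finite type splits the type into cyclically ordered orbits. -/
theorem Equiv.Perm.exists_orbit_enumeration {α : Type*} [Fintype α] (π : Equiv.Perm α) :
    ∃ (c : ℕ) (r : Fin c → ℕ) (x : Fin c → ℕ → α), (∀ t, 0 < r t) ∧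
      (∑ t, (Multiset.range (r t)).map (x t)) = Finset.univ.val ∧
      ∀ t i, π (x t i) = x t ((i + 1) % r t) := by
  classical
  let Q := Quotient (SameCycle.setoid π)
  let e : Fin (Fintype.card Q) ≃ Q := (Fintype.equivFin Q).symm
  have hper (a : α) : a ∈ periodicPts π := π.injective.mem_periodicPts a
  refine ⟨Fintype.card Q, fun t => minimalPeriod π (e t).out, fun t i => π^[i] (e t).out,
    fun t => minimalPeriod_pos_of_mem_periodicPts (hper _), ?_, fun t i => ?_⟩
  · have hmem (q : Q) (a : α) :
        a ∈ (Multiset.range (minimalPeriod π q.out)).map (fun i => π^[i] q.out) ↔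
          q = Quotient.mk _ a := by
      rw [← q.out_eq, Quotient.eq, q.out_eq, Multiset.mem_map]
      constructor
      · rintro ⟨i, -, rfl⟩
        exact ⟨i, by simp [Equiv.Perm.iterate_eq_pow]⟩
      · intro h
        obtain ⟨i, -, hi⟩ := SameCycle.exists_pow_eq' h
        refine ⟨i % minimalPeriod π q.out, Multiset.mem_range.2 (Nat.mod_lt _
          (minimalPeriod_pos_of_mem_periodicPts (hper _))), ?_⟩
        rw [iterate_mod_minimalPeriod_eq, iterate_eq_pow, hi]
    have hnodup (q : Q) :
        ((Multiset.range (minimalPeriod π q.out)).map (fun i => π^[i] q.out)).Nodup := by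
      refine Multiset.Nodup.map_on (fun i hi j hj h => ?_) (Multiset.nodup_range _)
      exact iterate_injOn_Iio_minimalPeriod (Multiset.mem_range.1 hi) (Multiset.mem_range.1 hj) h
    ext a
    rw [Multiset.count_sum', Finset.sum_eq_single (e.symm (Quotient.mk _ a))]
    · rw [Multiset.count_eq_one_of_mem (hnodup _) ((hmem _ _).2 (e.apply_symm_apply _)),
        Multiset.count_eq_one_of_mem Finset.univ.nodup (Finset.mem_univ a)]
    · exact fun t _ ht => Multiset.count_eq_zero.2 fun h =>
        ht (e.eq_symm_apply.2 ((hmem _ _).1 h))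
    · simp
  · simp only [iterate_mod_minimalPeriod_eq, iterate_succ_apply']

theorem Multiset.exists_fin_map_univ_eq {α : Type*} {n : ℕ} {s : Multiset α} (h : s.card = n) :
    ∃ f : Fin n → α, Finset.univ.val.map f = s := by
  obtain ⟨l, rfl⟩ : ∃ l : List α, (l : Multiset α) = s := ⟨s.toList, s.coe_toList⟩
  subst h
  exact ⟨l.get, (Fin.univ_val_map _).trans (congrArg _ (List.ofFn_get l))⟩

theorem Finset.exists_perm_of_map_univ_val_eq {ι β : Type*} [Fintype ι] {f g : ι → β}
    (h : Finset.univ.val.map f = Finset.univ.val.map g) : ∃ σ : Equiv.Perm ι, f = g ∘ σ := by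
  classical
  have hcard (b : β) : Fintype.card {i // f i = b} = Fintype.card {i // g i = b} := by
    simpa [Multiset.count_map, Fintype.card_subtype, Finset.card_def, eq_comm] using
      congrArg (Multiset.count b) h
  have e (b : β) : {i // f i = b} ≃ {i // g i = b} := Fintype.equivOfCardEq (hcard b)
  exact ⟨Equiv.ofFiberEquiv e, funext fun i => (Equiv.ofFiberEquiv_map e i).symm⟩

/-- Two multisets of pairs with the same projections differ by a permutation of the first
components. -/
theorem Multiset.exists_perm_of_map_fst_eq_of_map_snd_eq {V W : Type*} {A B : Multiset (V × W)}
    (hV : A.map Prod.fst = B.map Prod.fst) (hW : A.map Prod.snd = B.map Prod.snd) :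
    ∃ (n : ℕ) (a : Fin n → V × W) (π : Equiv.Perm (Fin n)),
      Finset.univ.val.map a = A ∧
      Finset.univ.val.map (fun i => ((a (π i)).1, (a i).2)) = B := by
  have hcard : B.card = A.card := by simpa using congrArg Multiset.card hV.symm
  generalize hn : A.card = n at hcard
  obtain ⟨a, rfl⟩ := Multiset.exists_fin_map_univ_eq hn
  obtain ⟨b, rfl⟩ := Multiset.exists_fin_map_univ_eq hcard
  rw [Multiset.map_map, Multiset.map_map] at hV hW
  obtain ⟨σ, hσ⟩ := Finset.exists_perm_of_map_univ_val_eq hV.symm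
  obtain ⟨τ, hτ⟩ := Finset.exists_perm_of_map_univ_val_eq hW
  refine ⟨_, a, τ.trans σ, rfl, ?_⟩
  have h (i) : ((a (τ.trans σ i)).1, (a i).2) = b (τ i) :=
    Prod.ext (congrFun hσ (τ i)).symm (congrFun hτ i)
  simp_rw [h]
  rw [← Function.comp_def b τ, ← Multiset.map_map, Multiset.map_univ_val_equiv]

theorem Multiset.map_sub_eq_map_sub {α β : Type*} [DecidableEq α] {f : α → β} {s t : Multiset α}
    (h : s.map f = t.map f) : (s - t).map f = (t - s).map f := by
  rw [← Multiset.sub_add_inter s t, Multiset.map_add] at h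
  nth_rw 3 [← Multiset.sub_add_inter t s] at h
  rw [Multiset.map_add, Multiset.inter_comm t s] at h
  exact add_right_cancel h

theorem Multiset.map_eq_map_of_countP_eq {α β : Type*} [DecidableEq β] {f : α → β}
    {s t : Multiset α} (h : ∀ b, s.countP (fun a => f a = b) = t.countP (fun a => f a = b)) :
    s.map f = t.map f := by
  ext b
  simpa [Multiset.count_map, Multiset.countP_eq_card_filter, eq_comm] using h b

/-- Let `G` and `H` be two bipartite multigraphs with vertex classes `V` and `W`, regarded as
multisets of edges in `V × W`.  If every vertex has the same degree with respect to `G` and to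
`H`, then the symmetric difference of the edge multisets, namely `(G - H) ∪ (H - G)`, can be
partitioned into even closed cycles alternating between `G - H` and `H - G`: there are cycles
`v_{t,0}, w_{t,0}, v_{t,1}, w_{t,1}, …, v_{t,r_t - 1}, w_{t,r_t - 1}` whose edges
`(v_{t,i}, w_{t,i})` are, with multiplicity, exactly `G - H` and whose edges
`(v_{t,i+1 mod r_t}, w_{t,i})` are, with multiplicity, exactly `H - G`. -/
theorem bipartite_multigraph_alternating_cycle_decomposition
    {V W : Type*} [DecidableEq V] [DecidableEq W] (G H : Multiset (V × W))
    (hdegV : ∀ v : V, G.countP (fun p => p.1 = v) = H.countP (fun p => p.1 = v))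
    (hdegW : ∀ w : W, G.countP (fun p => p.2 = w) = H.countP (fun p => p.2 = w)) :
    ∃ (c : ℕ) (r : Fin c → ℕ) (v : Fin c → ℕ → V) (w : Fin c → ℕ → W),
      (∀ t, 0 < r t) ∧
      (∑ t, (Multiset.range (r t)).map (fun i => (v t i, w t i))) = G - H ∧
      (∑ t, (Multiset.range (r t)).map (fun i => (v t ((i + 1) % r t), w t i))) = H - G := by
  obtain ⟨n, a, π, hA, hB⟩ := Multiset.exists_perm_of_map_fst_eq_of_map_snd_eq
    (Multiset.map_sub_eq_map_sub (Multiset.map_eq_map_of_countP_eq hdegV))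
    (Multiset.map_sub_eq_map_sub (Multiset.map_eq_map_of_countP_eq hdegW))
  obtain ⟨c, r, x, hr, hx, hπ⟩ := π.exists_orbit_enumeration
  refine ⟨c, r, fun t i => (a (x t i)).1, fun t i => (a (x t i)).2, hr, ?_, ?_⟩
  · rw [← hA, ← hx, ← Multiset.coe_mapAddMonoidHom, map_sum]
    simp
  · rw [← hB, ← hx, ← Multiset.coe_mapAddMonoidHom, map_sum]
    simp [hπ]
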